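/- Let n ≥ 5 and let r, s be integers with 2 ≤ r < s ≤ n−2. Let P = P(m) be the natural unit interval order on {1,…,n} with m_1 = r, m_i = n−1 for 2 ≤ i ≤ s, and m_i = n for s+1 ≤ i ≤ n−1, and let G = inc(P). Then every coefficient of the polynomial B_{(2,1^{n−2})}(t) is less than or equal to the corresponding coefficient of B_{(1^n)}(t) + B_{(3,1^{n−3})}(t). -/

import Mathlib

open scoped Classical

/-- The strict order relation of the natural unit interval order `P(m)` on `{1,…,n}`:
`i <_P j` iff `i ≤ n - 1` and `j > m i`. -/
def ltP (n : ℕ) (m : ℕ → ℕ) (i j : ℕ) : Prop := i ≤ n - 1 ∧ m i < j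

/-- A `P(m)`-tableau of shape `lam` (a list of row lengths, rows indexed from the top,
cells 0-based), encoded by the position function `pos` sending the value `x + 1`
(for `x : Fin n`) to its cell `(row, column)`: `pos` is a bijection from the values onto
the cells of the Young diagram of `lam`, rows increase strictly in `<_P` from left to
right, and `a_{i+1,j} <_P a_{i,j}` fails for vertically adjacent cells. -/
def IsPTab (n : ℕ) (m : ℕ → ℕ) (lam : List ℕ) (pos : Fin n → Fin n × Fin n) : Prop :=
  Function.Injective pos ∧
  (∀ c : Fin n × Fin n,
    (∃ x, pos x = c) ↔ c.1.val < lam.length ∧ c.2.val < lam.getD c.1.val 0) ∧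
  (∀ x y : Fin n, (pos y).1 = (pos x).1 → (pos y).2.val = (pos x).2.val + 1 →
    ltP n m (x.val + 1) (y.val + 1)) ∧
  (∀ x y : Fin n, (pos y).1.val = (pos x).1.val + 1 → (pos y).2 = (pos x).2 →
    ¬ ltP n m (y.val + 1) (x.val + 1))

/-- `inv_G(T)` for `G = inc(P(m))`: the number of edges `{i,j}` of `G` with `i < j`
such that `i` appears in a strictly lower row of the tableau than `j`. -/
noncomputable def invG (n : ℕ) (m : ℕ → ℕ) (pos : Fin n → Fin n × Fin n) : ℕ :=
  ((Finset.univ : Finset (Fin n × Fin n)).filter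
    (fun p => p.1 < p.2 ∧ p.2.val + 1 ≤ m (p.1.val + 1) ∧ (pos p.2).1 < (pos p.1).1)).card

/-- `B_λ(t) = Σ_T t^{inv_G(T)}`, summed over all `P(m)`-tableaux of shape `lam`. -/
noncomputable def Bpoly (n : ℕ) (m : ℕ → ℕ) (lam : List ℕ) : Polynomial ℤ :=
  ∑ pos ∈ (Finset.univ : Finset (Fin n → Fin n × Fin n)).filter (IsPTab n m lam),
    Polynomial.X ^ invG n m pos

/-- The natural unit interval order of the theorem, on the 0-based values `0,…,n-1`. -/
def rel (n r s x y : ℕ) : Prop := (x = 0 ∧ r ≤ y) ∨ (x < s ∧ y = n - 1)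

/-- Hook tableaux of shape `(k, 1^l)`, in terms of the row and column index of each value. -/
structure IsHook (n k l : ℕ) (L : ℕ → ℕ → Prop) (R C : Fin n → ℕ) : Prop where
  inj : ∀ x y, R x = R y → C x = C y → x = y
  cell : ∀ x, (R x = 0 ∧ C x < k) ∨ (1 ≤ R x ∧ R x ≤ l ∧ C x = 0)
  surj_row : ∀ j < k, ∃ x, R x = 0 ∧ C x = j
  surj_col : ∀ i, 1 ≤ i → i ≤ l → ∃ x, R x = i ∧ C x = 0
  row : ∀ x y : Fin n, R y = R x → C y = C x + 1 → L x y
  col : ∀ x y : Fin n, R y = R x + 1 → C y = C x → ¬ L y x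

lemma cell_hook_iff (k l a b : ℕ) :
    (a < (k :: List.replicate l 1).length ∧ b < (k :: List.replicate l 1).getD a 0) ↔
      (a = 0 ∧ b < k) ∨ (1 ≤ a ∧ a ≤ l ∧ b = 0) := by
  cases a with
  | zero => simp
  | succ a =>
    by_cases h : a < l
    · simp [h]
    · simp [h]

lemma isPTab_iff_isHook {n k l : ℕ} {m : ℕ → ℕ} (hk : 1 ≤ k) (hkl : k + l = n)
    (pos : Fin n → Fin n × Fin n) :
    IsPTab n m (k :: List.replicate l 1) pos ↔
      IsHook n k l (fun x y => ltP n m (x + 1) (y + 1))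
        (fun x => (pos x).1.val) (fun x => (pos x).2.val) := by
  constructor
  · rintro ⟨h1, h2, h3, h4⟩
    simp only [cell_hook_iff] at h2
    refine ⟨fun x y hR hC => h1 (Prod.ext (Fin.ext hR) (Fin.ext hC)),
      fun x => (h2 (pos x)).1 ⟨x, rfl⟩, fun j hj => ?_, fun i hi hil => ?_,
      fun x y hR hC => h3 x y (Fin.ext hR) hC, fun x y hR hC => h4 x y hR (Fin.ext hC)⟩
    · obtain ⟨x, hx⟩ := (h2 (⟨0, by omega⟩, ⟨j, by omega⟩)).2 (Or.inl ⟨rfl, hj⟩)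
      exact ⟨x, by simp [hx], by simp [hx]⟩
    · obtain ⟨x, hx⟩ := (h2 (⟨i, by omega⟩, ⟨0, by omega⟩)).2 (Or.inr ⟨hi, hil, rfl⟩)
      exact ⟨x, by simp [hx], by simp [hx]⟩
  · intro h
    refine ⟨fun x y hxy => h.inj x y (by simp [hxy]) (by simp [hxy]), fun c => ?_,
      fun x y hR hC => h.row x y (by simp [hR]) hC, fun x y hR hC => h.col x y hR (by simp [hC])⟩
    rw [cell_hook_iff]
    constructor
    · rintro ⟨x, rfl⟩
      exact h.cell x
    · rintro (⟨h0, hc⟩ | ⟨h0, hl, hc⟩)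
      · obtain ⟨x, hR, hC⟩ := h.surj_row _ hc
        exact ⟨x, Prod.ext (Fin.ext (by simp only [hR, h0])) (Fin.ext hC)⟩
      · obtain ⟨x, hR, hC⟩ := h.surj_col _ h0 hl
        exact ⟨x, Prod.ext (Fin.ext hR) (Fin.ext (by simp only [hC, hc]))⟩

lemma IsHook.congr_rel {n k l : ℕ} {L L' : ℕ → ℕ → Prop} {R C : Fin n → ℕ}
    (h : IsHook n k l L R C) (hL : ∀ x y : Fin n, L x y ↔ L' x y) : IsHook n k l L' R C :=
  ⟨h.inj, h.cell, h.surj_row, h.surj_col, fun x y hR hC => (hL x y).1 (h.row x y hR hC),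
    fun x y hR hC h' => h.col x y hR hC ((hL y x).2 h')⟩

lemma ltP_iff_rel {n r s : ℕ} {m : ℕ → ℕ} (hr : 2 ≤ r) (hs : s ≤ n - 2) (hrs : r < s)
    (hm1 : m 1 = r) (hmmid : ∀ i, 2 ≤ i → i ≤ s → m i = n - 1)
    (hmtop : ∀ i, s + 1 ≤ i → i ≤ n - 1 → m i = n) {x y : ℕ} (hy : y < n) :
    ltP n m (x + 1) (y + 1) ↔ rel n r s x y := by
  unfold ltP rel
  rcases Nat.eq_zero_or_pos x with rfl | hx
  · simp only [zero_add, hm1, true_and]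
    omega
  · by_cases hxs : x + 1 ≤ s
    · rw [hmmid (x + 1) (by omega) hxs]
      omega
    · by_cases hxn : x + 1 ≤ n - 1
      · rw [hmtop (x + 1) (by omega) hxn]
        omega
      · omega

lemma edge_iff_not_rel {n r s : ℕ} {m : ℕ → ℕ} (hr : 2 ≤ r) (hs : s ≤ n - 2) (hrs : r < s)
    (hm1 : m 1 = r) (hmmid : ∀ i, 2 ≤ i → i ≤ s → m i = n - 1)
    (hmtop : ∀ i, s + 1 ≤ i → i ≤ n - 1 → m i = n) {x y : ℕ} (hy : y < n) (hxy : x < y) :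
    y + 1 ≤ m (x + 1) ↔ ¬ rel n r s x y := by
  rw [← ltP_iff_rel hr hs hrs hm1 hmmid hmtop hy, ltP]
  omega

/-- The rows `R` and `R'` give the same inversions along the edges of the incomparability graph. -/
def SameInv (n : ℕ) (L : ℕ → ℕ → Prop) (R R' : Fin n → ℕ) : Prop :=
  ∀ x y : Fin n, x < y → ¬ L x y → (R' y < R' x ↔ R y < R x)

/-- The column tableau with rows `R'` is obtained from the tableau with rows `R` and columns `C`
by moving the maximum from the first row to just above the topmost of the values `s,…,n-2`. -/
def MovesMax (n s : ℕ) (R C R' C' : Fin n → ℕ) : Prop :=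
  (∀ z : Fin n, z.val = n - 1 → R z = 0 ∧ C z = 1 ∧ C' z = 0 ∧
    (∀ c : Fin n, s ≤ c.val → c ≠ z → R' z < R' c) ∧
    ∀ x, x ≠ z → (R x < R' z ∧ R' x = R x ∨ R' z ≤ R x ∧ R' x = R x + 1))

/-- The column tableau with rows `R'` is obtained from the tableau with rows `R` and columns `C`
and corner `0` by inserting the last entry of the first row directly below the corner. -/
def MovesArm (n s : ℕ) (R C R' C' : Fin n → ℕ) : Prop :=
  (∀ z : Fin n, z.val = 0 → R z = 0 ∧ C z = 0 ∧ ∀ x, x ≠ z → R' x = R x + 1) ∧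
  (∀ z : Fin n, z.val = n - 1 → C' z = 0 ∧ ∃ c : Fin n, s ≤ c.val ∧ c ≠ z ∧ R' c < R' z)

/-- The tableau `(R', C')` is obtained from `(R, C)`, in which the maximum is above all of the
values `s,…,n-2`, by moving the maximum to the end of the first row. -/
def LiftsMax (n s : ℕ) (R C R' C' : Fin n → ℕ) : Prop :=
  ∀ z : Fin n, z.val = n - 1 → 1 ≤ R z ∧ C z = 0 ∧ C' z = 2 ∧
    (∀ c : Fin n, s ≤ c.val → c ≠ z → R z < R c) ∧
    ∀ x, x ≠ z → C' x = C x ∧ (R x < R z ∧ R' x = R x ∨ R z < R x ∧ R' x = R x - 1)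

section Moves

variable {n r s : ℕ} {R C : Fin n → ℕ}

lemma IsHook.exists_movesMax (hr : 2 ≤ r) (hrs : r < s) (hs : s + 2 ≤ n)
    (h : IsHook n 2 (n - 2) (rel n r s) R C) {z : Fin n} (hz : z.val = n - 1)
    (hRz : R z = 0) (hCz : C z = 1) :
    ∃ R' : Fin n → ℕ, IsHook n 1 (n - 1) (rel n r s) R' (fun _ => 0) ∧
      SameInv n (rel n r s) R R' ∧ MovesMax n s R C R' (fun _ => 0) := by
  have hC : ∀ x, x ≠ z → C x = 0 := by
    intro x hx
    by_contra hc
    have := h.cell x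
    exact hx (h.inj x z (by omega) (by omega))
  obtain ⟨c₀, hc₀, hmin⟩ := Finset.exists_min_image
    (Finset.univ.filter fun c : Fin n => s ≤ c.val ∧ c ≠ z) R
    ⟨⟨s, by omega⟩, by simp [Fin.ext_iff]; omega⟩
  simp only [Finset.mem_filter, Finset.mem_univ, true_and, and_imp] at hc₀ hmin
  obtain ⟨hc₀s, hc₀z⟩ := hc₀
  have hc₀pos : 1 ≤ R c₀ := by
    by_contra h0
    have := h.row c₀ z (by omega) (by rw [hCz, hC c₀ hc₀z])
    unfold rel at this
    omega
  have hcell := h.cell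
  obtain ⟨R', hR'⟩ : ∃ R' : Fin n → ℕ, R' = fun x =>
      if x = z then R c₀ else if R x < R c₀ then R x else R x + 1 := ⟨_, rfl⟩
  have hR'z : R' z = R c₀ := by simp [hR']
  have hR'x : ∀ x, x ≠ z → (R x < R c₀ ∧ R' x = R x ∨ R c₀ ≤ R x ∧ R' x = R x + 1) := by
    intro x hx
    simp only [hR', if_neg hx]
    split_ifs <;> omega
  have hsurj : ∀ i < n, ∃ x, R' x = i := by
    intro i hi
    obtain hlt | rfl | hgt := lt_trichotomy i (R c₀)
    · have hx : ∃ x, R x = i ∧ C x = 0 := by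
        rcases Nat.eq_zero_or_pos i with rfl | hi0
        · exact h.surj_row 0 (by omega)
        · have := hcell c₀
          exact h.surj_col i hi0 (by omega)
      obtain ⟨x, hx, hx0⟩ := hx
      have := hR'x x (by rintro rfl; omega)
      exact ⟨x, by omega⟩
    · exact ⟨z, hR'z⟩
    · obtain ⟨x, hx, hx0⟩ := h.surj_col (i - 1) (by omega) (by omega)
      have := hR'x x (by rintro rfl; omega)
      exact ⟨x, by omega⟩
  refine ⟨R', ⟨?_, ?_, ?_, ?_, ?_, ?_⟩, ?_, ?_⟩
  · intro x y hxy _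
    by_cases hx : x = z <;> by_cases hy : y = z
    · rw [hx, hy]
    · have := hR'x y hy
      subst hx
      omega
    · have := hR'x x hx
      subst hy
      omega
    · have := hR'x x hx
      have := hR'x y hy
      exact h.inj x y (by omega) (by rw [hC x hx, hC y hy])
  · intro x
    have := hcell x
    have := hcell c₀
    by_cases hx : x = z
    · subst hx
      omega
    · have := hR'x x hx
      omega
  · intro j hj
    obtain ⟨x, hx⟩ := hsurj 0 (by omega)
    exact ⟨x, hx, by omega⟩
  · intro i _ hi
    obtain ⟨x, hx⟩ := hsurj i (by omega)
    exact ⟨x, hx, rfl⟩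
  · intro x y _ hc
    omega
  · intro x y hxy _ hrel
    by_cases hy : y = z
    · subst hy
      unfold rel at hrel
      omega
    have hy' := hR'x y hy
    by_cases hx : x = z
    · subst hx
      have : y = c₀ := h.inj _ _ (by omega) (by rw [hC y hy, hC c₀ hc₀z])
      subst this
      unfold rel at hrel
      omega
    · have hx' := hR'x x hx
      exact h.col x y (by omega) (by rw [hC x hx, hC y hy]) hrel
  · intro x y hxy hrel
    have hx : x ≠ z := by
      rintro rfl
      rw [Fin.lt_def] at hxy
      omega
    have hx' := hR'x x hx
    by_cases hy : y = z
    · subst hy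
      have : s ≤ x.val := by
        unfold rel at hrel
        omega
      have := hmin x this hx
      omega
    · have hy' := hR'x y hy
      omega
  · intro w hw
    obtain rfl : w = z := Fin.ext (by omega)
    refine ⟨hRz, hCz, rfl, fun c hcs hcz => ?_, fun x hx => ?_⟩
    · have := hmin c hcs hcz
      have := hR'x c hcz
      omega
    · rw [hR'z]
      exact hR'x x hx

lemma IsHook.exists_movesArm (hr : 2 ≤ r) (hrs : r < s) (hs : s + 2 ≤ n)
    (h : IsHook n 2 (n - 2) (rel n r s) R C) {o j z : Fin n} (ho : o.val = 0)
    (hz : z.val = n - 1) (hRo : R o = 0) (hCo : C o = 0) (hRj : R j = 0) (hCj : C j = 1)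
    (hjz : j ≠ z) (hjs : ¬ (j.val < s ∧ ∀ c : Fin n, s ≤ c.val → c ≠ z → R z < R c)) :
    ∃ R' : Fin n → ℕ, IsHook n 1 (n - 1) (rel n r s) R' (fun _ => 0) ∧
      SameInv n (rel n r s) R R' ∧ MovesArm n s R C R' (fun _ => 0) := by
  have hcell := h.cell
  have hoz : z ≠ o := by
    rintro rfl
    omega
  have hjo : j ≠ o := by
    rintro rfl
    omega
  have hrow : ∀ x, x ≠ o → R x = 0 → x = j := by
    intro x hx hx0
    have := hcell x
    by_cases hc : C x = 0
    · exact absurd (h.inj x o (by omega) (by omega)) hx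
    · exact h.inj x j (by omega) (by omega)
  have hRz : 1 ≤ R z := by
    by_contra h0
    exact hjz (hrow z hoz (by omega)).symm
  obtain ⟨R', hR'⟩ : ∃ R' : Fin n → ℕ, R' = fun x => if x = o then 0 else R x + 1 := ⟨_, rfl⟩
  have hR'o : R' o = 0 := by simp [hR']
  have hR'x : ∀ x, x ≠ o → R' x = R x + 1 := fun x hx => by simp [hR', hx]
  refine ⟨R', ⟨?_, ?_, ?_, ?_, ?_, ?_⟩, ?_, ?_, ?_⟩
  · intro x y hxy _
    by_cases hx : x = o <;> by_cases hy : y = o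
    · rw [hx, hy]
    · have := hR'x y hy
      subst hx
      omega
    · have := hR'x x hx
      subst hy
      omega
    · have hx' := hR'x x hx
      have hy' := hR'x y hy
      by_cases h0 : R x = 0
      · rw [hrow x hx h0, hrow y hy (by omega)]
      · have := hcell x
        have := hcell y
        exact h.inj x y (by omega) (by omega)
  · intro x
    have := hcell x
    by_cases hx : x = o
    · subst hx
      omega
    · have := hR'x x hx
      omega
  · intro i hi
    exact ⟨o, hR'o, by omega⟩
  · intro i hi hin
    by_cases hi1 : i = 1
    · exact ⟨j, by rw [hR'x j hjo, hRj, hi1], rfl⟩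
    · obtain ⟨x, hx, hx0⟩ := h.surj_col (i - 1) (by omega) (by omega)
      have := hR'x x (by rintro rfl; omega)
      exact ⟨x, by omega, rfl⟩
  · intro x y _ hc
    omega
  · intro x y hxy _ hrel
    have hy : y ≠ o := by
      rintro rfl
      omega
    have hyo : y.val ≠ 0 := fun hc => hy (Fin.ext (by omega))
    have hys : y.val < s ∧ x.val = n - 1 := by
      unfold rel at hrel
      omega
    obtain rfl : x = z := Fin.ext (by omega)
    have hx' := hR'x x hoz
    have hy' := hR'x y hy
    have := hcell x
    have := hcell y
    exact h.col x y (by omega) (by omega) hrel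
  · intro x y hxy _
    have hy : y ≠ o := by
      rintro rfl
      rw [Fin.lt_def] at hxy
      omega
    have hy' := hR'x y hy
    by_cases hx : x = o
    · subst hx
      omega
    · have hx' := hR'x x hx
      omega
  · intro w hw
    obtain rfl : w = o := Fin.ext (by omega)
    exact ⟨hRo, hCo, hR'x⟩
  · intro w hw
    obtain rfl : w = z := Fin.ext (by omega)
    refine ⟨rfl, ?_⟩
    have hw' := hR'x w hoz
    by_cases hj : s ≤ j.val
    · have := hR'x j hjo
      exact ⟨j, hj, hjz, by omega⟩
    · obtain ⟨c, hcs, hcw, hc⟩ : ∃ c : Fin n, s ≤ c.val ∧ c ≠ w ∧ R c ≤ R w := by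
        by_contra! hcon
        exact hjs ⟨by omega, hcon⟩
      have := hR'x c (by rintro rfl; omega)
      have hne : R c ≠ R w := by
        intro he
        have := hcell c
        have := hcell w
        exact hcw (h.inj c w he (by omega))
      exact ⟨c, hcs, hcw, by omega⟩

lemma IsHook.exists_liftsMax (hr : 2 ≤ r) (hrs : r < s) (hs : s + 2 ≤ n)
    (h : IsHook n 2 (n - 2) (rel n r s) R C) {o j z : Fin n} (ho : o.val = 0)
    (hz : z.val = n - 1) (hRo : R o = 0) (hCo : C o = 0) (hRj : R j = 0) (hCj : C j = 1)
    (hjz : j ≠ z) (hjs : j.val < s) (hzc : ∀ c : Fin n, s ≤ c.val → c ≠ z → R z < R c) :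
    ∃ R' C' : Fin n → ℕ, IsHook n 3 (n - 3) (rel n r s) R' C' ∧
      SameInv n (rel n r s) R R' ∧ LiftsMax n s R C R' C' := by
  have hcell := h.cell
  have hoz : o ≠ z := by
    rintro rfl
    omega
  have hRz : 1 ≤ R z := by
    by_contra h0
    have := hcell z
    by_cases hc : C z = 0
    · exact hoz (h.inj o z (by omega) (by omega))
    · exact hjz (h.inj j z (by omega) (by omega))
  have hne : ∀ x, x ≠ z → R x ≠ R z := by
    intro x hx he
    have := hcell x
    have := hcell z
    exact hx (h.inj x z he (by omega))
  obtain ⟨R', hR'⟩ : ∃ R' : Fin n → ℕ, R' = fun x =>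
      if x = z then 0 else if R x < R z then R x else R x - 1 := ⟨_, rfl⟩
  obtain ⟨C', hC'⟩ : ∃ C' : Fin n → ℕ, C' = fun x => if x = z then 2 else C x := ⟨_, rfl⟩
  have hR'z : R' z = 0 := by simp [hR']
  have hC'z : C' z = 2 := by simp [hC']
  have hx' : ∀ x, x ≠ z →
      C' x = C x ∧ (R x < R z ∧ R' x = R x ∨ R z < R x ∧ R' x = R x - 1) := by
    intro x hx
    have := hne x hx
    simp only [hR', hC', if_neg hx, true_and]
    split_ifs <;> omega
  have hzcell := hcell z
  refine ⟨R', C', ⟨?_, ?_, ?_, ?_, ?_, ?_⟩, ?_, ?_⟩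
  · intro x y hR hC
    by_cases hx : x = z <;> by_cases hy : y = z
    · rw [hx, hy]
    · have := hx' y hy
      have := hcell y
      subst hx
      omega
    · have := hx' x hx
      have := hcell x
      subst hy
      omega
    · have := hx' x hx
      have := hx' y hy
      exact h.inj x y (by omega) (by omega)
  · intro x
    have := hcell x
    by_cases hx : x = z
    · subst hx
      omega
    · have := hx' x hx
      omega
  · intro i hi
    obtain rfl | rfl | rfl : i = 0 ∨ i = 1 ∨ i = 2 := by omega
    · have := hx' o hoz
      exact ⟨o, by omega, by omega⟩
    · have := hx' j hjz
      exact ⟨j, by omega, by omega⟩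
    · exact ⟨z, hR'z, hC'z⟩
  · intro i hi hin
    by_cases hik : i < R z
    · obtain ⟨x, hx, hx0⟩ := h.surj_col i hi (by omega)
      have := hx' x (by rintro rfl; omega)
      exact ⟨x, by omega, by omega⟩
    · obtain ⟨x, hx, hx0⟩ := h.surj_col (i + 1) (by omega) (by omega)
      have := hx' x (by rintro rfl; omega)
      exact ⟨x, by omega, by omega⟩
  · intro x y hR hC
    have hxc := hcell x
    have hyc := hcell y
    have hx : x ≠ z := by
      rintro rfl
      by_cases hy : y = x
      · subst hy
        omega
      · have := hx' y hy
        omega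
    have hx1 := hx' x hx
    by_cases hy : y = z
    · subst hy
      obtain rfl : x = j := h.inj x j (by omega) (by omega)
      exact Or.inr ⟨hjs, hz⟩
    · have hy1 := hx' y hy
      exact h.row x y (by omega) (by omega)
  · intro x y hR hC hrel
    have hy : y ≠ z := by
      rintro rfl
      omega
    have hy1 := hx' y hy
    have hyc := hcell y
    rcases hrel with ⟨hy0, _⟩ | ⟨_, hxn⟩
    · obtain rfl : y = o := Fin.ext (by omega)
      omega
    · obtain rfl : x = z := Fin.ext (by omega)
      omega
  · intro x y hxy hrel
    have hx : x ≠ z := by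
      rintro rfl
      rw [Fin.lt_def] at hxy
      omega
    have hx1 := hx' x hx
    by_cases hy : y = z
    · subst hy
      have hxs : s ≤ x.val := by
        unfold rel at hrel
        omega
      have := hzc x hxs hx
      omega
    · have hy1 := hx' y hy
      omega
  · intro w hw
    obtain rfl : w = z := Fin.ext (by omega)
    exact ⟨hRz, by omega, hC'z, hzc, hx'⟩

end Moves

section Uniqueness

variable {n r s : ℕ} {R₁ C₁ R₂ C₂ R' C' : Fin n → ℕ}

lemma MovesMax.left_unique (hn : 1 ≤ n)
    (h₁ : IsHook n 2 (n - 2) (rel n r s) R₁ C₁) (h₂ : IsHook n 2 (n - 2) (rel n r s) R₂ C₂)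
    (m₁ : MovesMax n s R₁ C₁ R' C') (m₂ : MovesMax n s R₂ C₂ R' C') (x : Fin n) :
    R₁ x = R₂ x ∧ C₁ x = C₂ x := by
  let z : Fin n := ⟨n - 1, by omega⟩
  obtain ⟨hR₁, hC₁, -, -, hx₁⟩ := m₁ z rfl
  obtain ⟨hR₂, hC₂, -, -, hx₂⟩ := m₂ z rfl
  by_cases hx : x = z
  · subst hx
    omega
  · have := hx₁ x hx
    have := hx₂ x hx
    have := h₁.cell x
    have := h₂.cell x
    have : C₁ x ≠ 1 := fun hc => hx (h₁.inj x z (by omega) (by omega))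
    have : C₂ x ≠ 1 := fun hc => hx (h₂.inj x z (by omega) (by omega))
    omega

lemma MovesArm.left_unique (hn : 1 ≤ n)
    (h₁ : IsHook n 2 (n - 2) (rel n r s) R₁ C₁) (h₂ : IsHook n 2 (n - 2) (rel n r s) R₂ C₂)
    (m₁ : MovesArm n s R₁ C₁ R' C') (m₂ : MovesArm n s R₂ C₂ R' C') (x : Fin n) :
    R₁ x = R₂ x ∧ C₁ x = C₂ x := by
  let o : Fin n := ⟨0, by omega⟩
  obtain ⟨hR₁, hC₁, hx₁⟩ := m₁.1 o rfl
  obtain ⟨hR₂, hC₂, hx₂⟩ := m₂.1 o rfl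
  by_cases hx : x = o
  · subst hx
    omega
  · have := hx₁ x hx
    have := hx₂ x hx
    have := h₁.cell x
    have := h₂.cell x
    have : ¬ (R₁ x = 0 ∧ C₁ x = 0) := fun hc => hx (h₁.inj x o (by omega) (by omega))
    have : ¬ (R₂ x = 0 ∧ C₂ x = 0) := fun hc => hx (h₂.inj x o (by omega) (by omega))
    omega

lemma LiftsMax.le (hs : s + 2 ≤ n) (h₁ : IsHook n 2 (n - 2) (rel n r s) R₁ C₁)
    (m₁ : LiftsMax n s R₁ C₁ R' C') (m₂ : LiftsMax n s R₂ C₂ R' C') {z : Fin n}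
    (hz : z.val = n - 1) : R₂ z ≤ R₁ z := by
  obtain ⟨hR₁, hC₁, -, hc₁, hx₁⟩ := m₁ z hz
  obtain ⟨-, -, -, hc₂, hx₂⟩ := m₂ z hz
  by_contra! hlt
  have hsz : (⟨s, by omega⟩ : Fin n) ≠ z := by
    intro he
    have := congrArg Fin.val he
    simp only at this
    omega
  have := hc₁ ⟨s, by omega⟩ le_rfl hsz
  have := h₁.cell ⟨s, by omega⟩
  obtain ⟨y, hy, hy0⟩ := h₁.surj_col (R₁ z + 1) (by omega) (by omega)
  have hyz : y ≠ z := by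
    rintro rfl
    omega
  have hys : s ≤ y.val := by
    have := h₁.col z y hy (by omega)
    unfold rel at this
    omega
  have := hc₂ y hys hyz
  have := hx₁ y hyz
  have := hx₂ y hyz
  omega

lemma LiftsMax.left_unique (hs : s + 2 ≤ n)
    (h₁ : IsHook n 2 (n - 2) (rel n r s) R₁ C₁) (h₂ : IsHook n 2 (n - 2) (rel n r s) R₂ C₂)
    (m₁ : LiftsMax n s R₁ C₁ R' C') (m₂ : LiftsMax n s R₂ C₂ R' C') (x : Fin n) :
    R₁ x = R₂ x ∧ C₁ x = C₂ x := by
  let z : Fin n := ⟨n - 1, by omega⟩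
  have := LiftsMax.le hs h₁ m₁ m₂ (z := z) rfl
  have := LiftsMax.le hs h₂ m₂ m₁ (z := z) rfl
  obtain ⟨-, hC₁, -, -, hx₁⟩ := m₁ z rfl
  obtain ⟨-, hC₂, -, -, hx₂⟩ := m₂ z rfl
  by_cases hx : x = z
  · subst hx
    omega
  · have := hx₁ x hx
    have := hx₂ x hx
    omega

/-- The relation underlying the weight-preserving injection from tableaux of shape `(2, 1^{n-2})`
to tableaux of shape `(1^n)` or `(3, 1^{n-3})`. -/
def Moves (n s : ℕ) (R C R' C' : Fin n → ℕ) : Prop :=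
  MovesMax n s R C R' C' ∨ MovesArm n s R C R' C' ∨ LiftsMax n s R C R' C'

lemma MovesMax.not_movesArm (hn : 1 ≤ n) (m₁ : MovesMax n s R₁ C₁ R' C') :
    ¬ MovesArm n s R₂ C₂ R' C' := by
  intro m₂
  obtain ⟨-, -, -, hc, -⟩ := m₁ ⟨n - 1, by omega⟩ rfl
  obtain ⟨-, c, hcs, hcz, hlt⟩ := m₂.2 ⟨n - 1, by omega⟩ rfl
  have := hc c hcs hcz
  omega

lemma LiftsMax.not_movesMax (hn : 1 ≤ n) (m₁ : LiftsMax n s R₁ C₁ R' C') :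
    ¬ MovesMax n s R₂ C₂ R' C' := by
  intro m₂
  have := m₁ ⟨n - 1, by omega⟩ rfl
  have := m₂ ⟨n - 1, by omega⟩ rfl
  omega

lemma LiftsMax.not_movesArm (hn : 1 ≤ n) (m₁ : LiftsMax n s R₁ C₁ R' C') :
    ¬ MovesArm n s R₂ C₂ R' C' := by
  intro m₂
  have := m₁ ⟨n - 1, by omega⟩ rfl
  have := m₂.2 ⟨n - 1, by omega⟩ rfl
  omega

lemma Moves.left_unique (hs : s + 2 ≤ n)
    (h₁ : IsHook n 2 (n - 2) (rel n r s) R₁ C₁) (h₂ : IsHook n 2 (n - 2) (rel n r s) R₂ C₂)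
    (m₁ : Moves n s R₁ C₁ R' C') (m₂ : Moves n s R₂ C₂ R' C') (x : Fin n) :
    R₁ x = R₂ x ∧ C₁ x = C₂ x := by
  have hn : 1 ≤ n := by omega
  rcases m₁ with m₁ | m₁ | m₁ <;> rcases m₂ with m₂ | m₂ | m₂
  · exact m₁.left_unique hn h₁ h₂ m₂ x
  · exact absurd m₂ (m₁.not_movesArm hn)
  · exact absurd m₁ (m₂.not_movesMax hn)
  · exact absurd m₁ (m₂.not_movesArm hn)
  · exact m₁.left_unique hn h₁ h₂ m₂ x
  · exact absurd m₁ (m₂.not_movesArm hn)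
  · exact absurd m₂ (m₁.not_movesMax hn)
  · exact absurd m₂ (m₁.not_movesArm hn)
  · exact m₁.left_unique hs h₁ h₂ m₂ x

end Uniqueness

lemma IsHook.exists_moves {n r s : ℕ} {R C : Fin n → ℕ} (hr : 2 ≤ r) (hrs : r < s)
    (hs : s + 2 ≤ n) (h : IsHook n 2 (n - 2) (rel n r s) R C) :
    ∃ R' C' : Fin n → ℕ,
      (IsHook n 1 (n - 1) (rel n r s) R' C' ∨ IsHook n 3 (n - 3) (rel n r s) R' C') ∧
      SameInv n (rel n r s) R R' ∧ Moves n s R C R' C' := by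
  let z : Fin n := ⟨n - 1, by omega⟩
  obtain ⟨o, hRo, hCo⟩ := h.surj_row 0 (by omega)
  obtain ⟨j, hRj, hCj⟩ := h.surj_row 1 (by omega)
  by_cases hjz : j = z
  · subst hjz
    obtain ⟨R', h', hinv, hm⟩ := h.exists_movesMax hr hrs hs (z := z) rfl hRj hCj
    exact ⟨R', _, Or.inl h', hinv, Or.inl hm⟩
  have ho : o.val = 0 := by
    have hrel := h.row o j (by omega) (by omega)
    have : j.val ≠ n - 1 := fun hc => hjz (Fin.ext hc)
    unfold rel at hrel
    omega
  by_cases hjs : j.val < s ∧ ∀ c : Fin n, s ≤ c.val → c ≠ z → R z < R c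
  · obtain ⟨R', C', h', hinv, hm⟩ :=
      h.exists_liftsMax hr hrs hs ho (z := z) rfl hRo hCo hRj hCj hjz hjs.1 hjs.2
    exact ⟨R', C', Or.inr h', hinv, Or.inr (Or.inr hm)⟩
  · obtain ⟨R', h', hinv, hm⟩ :=
      h.exists_movesArm hr hrs hs ho (z := z) rfl hRo hCo hRj hCj hjz hjs
    exact ⟨R', _, Or.inl h', hinv, Or.inr (Or.inl hm)⟩

lemma IsHook.exists_pos {n k l : ℕ} {L : ℕ → ℕ → Prop} {R C : Fin n → ℕ} (hk : 1 ≤ k)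
    (hkl : k + l = n) (h : IsHook n k l L R C) :
    ∃ pos : Fin n → Fin n × Fin n,
      R = (fun x => (pos x).1.val) ∧ C = (fun x => (pos x).2.val) :=
  ⟨fun x => (⟨R x, by have := h.cell x; omega⟩, ⟨C x, by have := h.cell x; omega⟩), rfl, rfl⟩

lemma coeff_Bpoly (n : ℕ) (m : ℕ → ℕ) (lam : List ℕ) (i : ℕ) :
    (Bpoly n m lam).coeff i =
      ((Finset.univ.filter fun pos => IsPTab n m lam pos ∧ invG n m pos = i).card : ℤ) := by
  simp only [Bpoly, Polynomial.finsetSum_coeff, Polynomial.coeff_X_pow, Finset.sum_boole,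
    Finset.filter_filter, eq_comm]

/-- In the same situation, every coefficient of `B_{(2,1^{n-2})}(t)`
is at most the corresponding coefficient of `B_{(1^n)}(t) + B_{(3,1^{n-3})}(t)`. -/
theorem stmt_12 (n r s : ℕ) (hn : 5 ≤ n) (hr : 2 ≤ r) (hrs : r < s) (hs : s ≤ n - 2)
    (m : ℕ → ℕ) (hm1 : m 1 = r)
    (hmmid : ∀ i, 2 ≤ i → i ≤ s → m i = n - 1)
    (hmtop : ∀ i, s + 1 ≤ i → i ≤ n - 1 → m i = n) :
    ∀ i : ℕ, (Bpoly n m (2 :: List.replicate (n - 2) 1)).coeff i ≤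
      (Bpoly n m (List.replicate n 1)
        + Bpoly n m (3 :: List.replicate (n - 3) 1)).coeff i := by
  intro i
  have hs' : s + 2 ≤ n := by omega
  have hL : ∀ x y : Fin n, ltP n m (x + 1) (y + 1) ↔ rel n r s x y := fun x y =>
    ltP_iff_rel hr hs hrs hm1 hmmid hmtop y.2
  have htab : ∀ {k l : ℕ}, 1 ≤ k → k + l = n → ∀ pos : Fin n → Fin n × Fin n,
      IsPTab n m (k :: List.replicate l 1) pos ↔
        IsHook n k l (rel n r s) (fun x => (pos x).1.val) (fun x => (pos x).2.val) :=
    fun hk hkl pos => (isPTab_iff_isHook hk hkl pos).trans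
      ⟨fun h => h.congr_rel hL, fun h => h.congr_rel fun x y => (hL x y).symm⟩
  have hinv : ∀ p q : Fin n → Fin n × Fin n,
      SameInv n (rel n r s) (fun x => (p x).1.val) (fun x => (q x).1.val) →
        invG n m q = invG n m p := by
    intro p q hpq
    unfold invG
    congr 1
    refine Finset.filter_congr fun e _ => and_congr_right fun hlt => and_congr_right fun he => ?_
    exact hpq e.1 e.2 hlt ((edge_iff_not_rel hr hs hrs hm1 hmmid hmtop e.2.2 hlt).1 he)
  have hcol : List.replicate n 1 = 1 :: List.replicate (n - 1) 1 := by
    rw [← List.replicate_succ]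
    congr 1
    omega
  rw [Polynomial.coeff_add, coeff_Bpoly, coeff_Bpoly, coeff_Bpoly, hcol]
  norm_cast
  refine le_trans ?_ (Finset.card_union_le _ _)
  refine Finset.card_le_card_of_forall_subsingleton
    (fun p q => Moves n s (fun x => (p x).1.val) (fun x => (p x).2.val)
      (fun x => (q x).1.val) (fun x => (q x).2.val)) ?_ ?_
  · intro p hp
    simp only [Finset.mem_filter, Finset.mem_univ, true_and] at hp
    obtain ⟨hp, hpi⟩ := hp
    obtain ⟨R', C', h', hsame, hm⟩ :=
      ((htab (by omega) (by omega) p).1 hp).exists_moves hr hrs hs'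
    obtain ⟨q, rfl, rfl⟩ : ∃ q : Fin n → Fin n × Fin n,
        R' = (fun x => (q x).1.val) ∧ C' = (fun x => (q x).2.val) := by
      rcases h' with h' | h'
      · exact h'.exists_pos (by omega) (by omega)
      · exact h'.exists_pos (by omega) (by omega)
    refine ⟨q, ?_, hm⟩
    have hqi := (hinv p q hsame).trans hpi
    simp only [Finset.mem_union, Finset.mem_filter, Finset.mem_univ, true_and]
    exact h'.imp (fun h' => ⟨(htab (by omega) (by omega) q).2 h', hqi⟩)
      (fun h' => ⟨(htab (by omega) (by omega) q).2 h', hqi⟩)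
  · rintro q - p₁ ⟨hp₁, hm₁⟩ p₂ ⟨hp₂, hm₂⟩
    simp only [Finset.mem_filter, Finset.mem_univ, true_and] at hp₁ hp₂
    funext x
    have := Moves.left_unique hs' ((htab (by omega) (by omega) p₁).1 hp₁.1)
      ((htab (by omega) (by omega) p₂).1 hp₂.1) hm₁ hm₂ x
    exact Prod.ext (Fin.ext this.1) (Fin.ext this.2)
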